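/- For every ε > 0 and every integer p ≥ 2, set γ = min{1/(2p²), ε/2} and η = p^{−10p}·ε. Then for all n ≥ 10 the following holds: if G is a graph on n vertices with minimum degree at least (1 − 1/(p−1) − γ)n and G contains at most η·n^p copies of K_p, then there is a partition V(G) = V₁ ⊔ ⋯ ⊔ V_{p−1} such that (i) the total number of edges inside the parts satisfies Σ_{i=1}^{p−1} e(V_i) ≤ ε·C(n,2); (ii) ||V_i| − n/(p−1)| ≤ √(2ε)·n for every i; (iii) e(V_i, V_j) ≥ (1 − p²ε)|V_i||V_j| for all i ≠ j; and (iv) for every i ≠ j and every v ∈ V_i, the number of neighbors of v in V_i is at most the number of neighbors of v in V_j. -/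

import Mathlib

open SimpleGraph

/-- `G` contains a copy of `H` (as a subgraph, i.e. there is an injective graph homomorphism). -/
def HasCopy {V W : Type*} (G : SimpleGraph V) (H : SimpleGraph W) : Prop :=
  ∃ f : H →g G, Function.Injective f

/-- The Ramsey number `r(H₁, H₂)`: the smallest `N` such that every graph `G` on `N` vertices
contains `H₁` as a subgraph or its complement contains `H₂` as a subgraph. -/
noncomputable def ramseyNumber {V W : Type*} (H₁ : SimpleGraph V) (H₂ : SimpleGraph W) : ℕ :=
  sInf {N : ℕ | ∀ G : SimpleGraph (Fin N), HasCopy G H₁ ∨ HasCopy Gᶜ H₂}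

/-- The complete multipartite graph `K_p(a₁,…,a_p)` with parts of sizes `a 0, …, a (p-1)`. -/
def KMulti {p : ℕ} (a : Fin p → ℕ) : SimpleGraph (Σ i : Fin p, Fin (a i)) :=
  completeMultipartiteGraph fun i => Fin (a i)

/-- The book graph `B_{k,n}`: the join of `K_k` with an independent set of `n - k` vertices,
realized as the complete multipartite graph with `k` parts of size `1` and one part of
size `n - k`. -/
def Book (k n : ℕ) : SimpleGraph (Σ i : Fin (k + 1), Fin (if (i : ℕ) < k then 1 else n - k)) :=
  completeMultipartiteGraph fun i : Fin (k + 1) => Fin (if (i : ℕ) < k then 1 else n - k)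

/-- The number of neighbors of `v` inside the set `A`. -/
noncomputable def degIn {V : Type*} (G : SimpleGraph V) (v : V) (A : Set V) : ℕ :=
  {u ∈ A | G.Adj v u}.ncard

/-- `e(A)`: the number of edges of `G` with both endpoints in `A`. -/
noncomputable def eIn {V : Type*} (G : SimpleGraph V) (A : Set V) : ℕ :=
  {e ∈ G.edgeSet | ∀ v ∈ e, v ∈ A}.ncard

/-- `e(A, B)`: the number of edges of `G` with one endpoint in `A` and the other in `B`
(for disjoint `A`, `B`), counted as ordered pairs. -/
noncomputable def eBetween {V : Type*} (G : SimpleGraph V) (A B : Set V) : ℕ :=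
  {x : V × V | x.1 ∈ A ∧ x.2 ∈ B ∧ G.Adj x.1 x.2}.ncard

/-- The indicator of adjacency, as a real number. -/
noncomputable def adjInd {V : Type*} (G : SimpleGraph V) (u v : V) : ℝ :=
  open Classical in if G.Adj u v then 1 else 0

/-- The neighbors of `x` inside the finite set `A`. -/
noncomputable def nbrIn {V : Type*} (G : SimpleGraph V) (x : V) (A : Finset V) : Finset V :=
  open Classical in A.filter (G.Adj x)

/-- The number of sequences of `q` pairwise adjacent vertices of `A`. -/
noncomputable def cliqueSeqCount {V : Type*} (G : SimpleGraph V) : ℕ → Finset V → ℕ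
  | 0, _ => 1
  | q + 1, A => ∑ x ∈ A, cliqueSeqCount G q (nbrIn G x A)

/-- The number of ordered adjacent pairs of vertices with equal colors. -/
noncomputable def monoCount {V α : Type*} [Fintype V] (G : SimpleGraph V) (c : V → α) : ℝ :=
  open Classical in ∑ u, ∑ v, if c u = c v then adjInd G u v else 0

lemma adjInd_comm {V : Type*} (G : SimpleGraph V) (u v : V) : adjInd G u v = adjInd G v u := by
  unfold adjInd; rw [G.adj_comm]

lemma adjInd_le_one {V : Type*} (G : SimpleGraph V) (u v : V) : adjInd G u v ≤ 1 := by
  unfold adjInd; split_ifs <;> norm_num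

lemma card_nbrIn {V : Type*} (G : SimpleGraph V) (x : V) (A : Finset V) :
    ((nbrIn G x A).card : ℝ) = ∑ v ∈ A, adjInd G x v := by
  classical
  simp [nbrIn, adjInd, Finset.sum_boole]

open Classical in
lemma cliqueSeqCount_le {V : Type*} (G : SimpleGraph V) (q : ℕ) (A : Finset V) :
    cliqueSeqCount G q A ≤ q.factorial * (A.powerset.filter (G.IsNClique q)).card := by
  induction q generalizing A with
  | zero =>
    have : ∅ ∈ A.powerset.filter (G.IsNClique 0) := by simp
    rw [cliqueSeqCount, Nat.factorial_zero, one_mul]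
    exact Finset.card_pos.2 ⟨∅, this⟩
  | succ q ih =>
    have key : ∑ x ∈ A, ((nbrIn G x A).powerset.filter (G.IsNClique q)).card ≤
        (q + 1) * (A.powerset.filter (G.IsNClique (q + 1))).card := by
      have h2 : (q + 1) * (A.powerset.filter (G.IsNClique (q + 1))).card =
          ((A.powerset.filter (G.IsNClique (q + 1))).sigma fun s => s).card := by
        rw [Finset.card_sigma, Finset.sum_const_nat (m := q + 1), mul_comm]
        intro s hs
        exact (Finset.mem_filter.1 hs).2.card_eq
      rw [h2, ← Finset.card_sigma A fun x => (nbrIn G x A).powerset.filter (G.IsNClique q)]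
      have hx : ∀ x ∈ A, ∀ s ∈ (nbrIn G x A).powerset.filter (G.IsNClique q),
          s ⊆ A ∧ G.IsNClique q s ∧ ∀ b ∈ s, G.Adj x b := by
        intro x _ s hs
        rw [Finset.mem_filter, Finset.mem_powerset] at hs
        refine ⟨fun b hb => (Finset.mem_filter.1 (hs.1 hb)).1, hs.2,
          fun b hb => (Finset.mem_filter.1 (hs.1 hb)).2⟩
      refine Finset.card_le_card_of_injOn
        (fun z : (_ : V) × Finset V => (⟨insert z.1 z.2, z.1⟩ : (_ : Finset V) × V)) ?_ ?_
      · rintro ⟨x, s⟩ hz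
        obtain ⟨hxA, hs⟩ := Finset.mem_sigma.1 hz
        obtain ⟨h1, h2, h3⟩ := hx x hxA s hs
        refine Finset.mem_sigma.2 ⟨Finset.mem_filter.2 ⟨?_, h2.insert h3⟩, by simp⟩
        exact Finset.mem_powerset.2 (Finset.insert_subset hxA h1)
      · rintro ⟨x, s⟩ hz ⟨y, r⟩ hw h
        obtain ⟨hxA, hs⟩ := Finset.mem_sigma.1 hz
        obtain ⟨hyA, hr⟩ := Finset.mem_sigma.1 hw
        obtain ⟨-, -, h3⟩ := hx x hxA s hs
        obtain ⟨-, -, h3'⟩ := hx y hyA r hr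
        simp only [Sigma.mk.injEq, heq_eq_eq] at h
        obtain ⟨h, rfl⟩ := h
        have hxs : x ∉ s := fun hm => G.loopless.irrefl x (h3 x hm)
        have hxr : x ∉ r := fun hm => G.loopless.irrefl x (h3' x hm)
        have : s = r := by
          rw [← Finset.erase_insert hxs, ← Finset.erase_insert hxr, h]
        rw [this]
    calc cliqueSeqCount G (q + 1) A
        = ∑ x ∈ A, cliqueSeqCount G q (nbrIn G x A) := rfl
      _ ≤ ∑ x ∈ A, q.factorial * ((nbrIn G x A).powerset.filter (G.IsNClique q)).card :=
          Finset.sum_le_sum fun x _ => ih _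
      _ ≤ q.factorial * ((q + 1) * (A.powerset.filter (G.IsNClique (q + 1))).card) := by
          rw [← Finset.mul_sum]; exact Nat.mul_le_mul_left _ key
      _ = _ := by rw [Nat.factorial_succ]; ring

lemma cliqueSeqCount_univ_le {V : Type*} [Fintype V] (G : SimpleGraph V) (q : ℕ) :
    (cliqueSeqCount G q Finset.univ : ℝ) ≤
      q.factorial * ({s : Finset V | G.IsNClique q s}.ncard : ℝ) := by
  classical
  have h := cliqueSeqCount_le G q Finset.univ
  rw [← Set.ncard_coe_finset] at h
  simp only [Finset.powerset_univ, Finset.coe_filter, Finset.mem_univ, true_and] at h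
  rw [← Nat.cast_mul]
  exact Nat.cast_le.2 h

/-- Füredi's stability inequality with an error term counting cliques: averaging over the vertex
whose non-neighborhood becomes a color class replaces the choice of a vertex of maximum degree. -/
lemma exists_coloring_le_cliqueSeqCount {V : Type*} (G : SimpleGraph V) (δ b : ℝ) (hδ : 0 ≤ δ)
    (hb : 0 < b) (hdeg : ∀ (A : Finset V) x, (A.card : ℝ) - δ ≤ (nbrIn G x A).card)
    (j : ℕ) (A : Finset V) (hA : b + j * δ ≤ A.card + δ) :
    ∃ c : V → ℕ, (∀ v, c v ≤ j) ∧
      ∑ u ∈ A, ∑ v ∈ A, (adjInd G u v + if c u = c v then adjInd G u v else -1) ≤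
        2 * cliqueSeqCount G (j + 2) A / b ^ j := by
  classical
  induction j generalizing A with
  | zero =>
    refine ⟨fun _ => 0, fun _ => le_rfl, ?_⟩
    simp only [cliqueSeqCount, if_true, pow_zero, div_one, Nat.cast_sum, Finset.sum_const,
      smul_eq_mul, mul_one, card_nbrIn, Finset.mul_sum]
    exact (Finset.sum_congr rfl fun u _ => Finset.sum_congr rfl fun v _ => by ring).le
  | succ j ih =>
    push_cast at hA
    have hj : 0 ≤ (j : ℝ) * δ := by positivity
    have hAb : b ≤ A.card := by linarith
    have hstep : ∀ x, ∃ c : V → ℕ, (∀ v, c v ≤ j) ∧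
        ∑ u ∈ nbrIn G x A, ∑ v ∈ nbrIn G x A,
          (adjInd G u v + if c u = c v then adjInd G u v else -1) ≤
          2 * cliqueSeqCount G (j + 2) (nbrIn G x A) / b ^ j := by
      intro x
      refine ih (nbrIn G x A) ?_
      have := hdeg A x
      linarith
    choose c hcj hc using hstep
    let c' : V → V → ℕ := fun x v => if G.Adj x v then c x v else j + 1
    let d : V → ℝ := fun u => ∑ v ∈ A, adjInd G u v
    have hF : ∀ x, ∑ u ∈ A, ∑ v ∈ A,
        (adjInd G u v + if c' x u = c' x v then adjInd G u v else -1) ≤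
        2 * cliqueSeqCount G (j + 2) (nbrIn G x A) / b ^ j +
          2 * ∑ v ∈ A, (1 - adjInd G x v) * (d v - d x) := by
      intro x
      refine le_trans (le_of_eq ?_) (add_le_add_left (hc x) _)
      have h1 : ∀ f : V → ℝ, ∑ u ∈ nbrIn G x A, f u = ∑ u ∈ A, adjInd G x u * f u := by
        intro f
        simp [nbrIn, adjInd, Finset.sum_filter]
      have h2 : ∑ u ∈ A, ∑ v ∈ A,
          (adjInd G u v + if c' x u = c' x v then adjInd G u v else -1) =
          ∑ u ∈ A, ∑ v ∈ A, (adjInd G x u * (adjInd G x v *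
            (adjInd G u v + if c x u = c x v then adjInd G u v else -1)) +
            ((1 - adjInd G x u) * (adjInd G u v - adjInd G x v) +
             (1 - adjInd G x v) * (adjInd G v u - adjInd G x u))) := by
        refine Finset.sum_congr rfl fun u _ => Finset.sum_congr rfl fun v _ => ?_
        rw [adjInd_comm G v u]
        have hu := hcj x u
        have hv := hcj x v
        by_cases hxu : G.Adj x u <;> by_cases hxv : G.Adj x v
        · simp [c', adjInd, hxu, hxv]
        · have : c x u ≠ j + 1 := by omega
          simp [c', adjInd, hxu, hxv, this]; ring
        · have : j + 1 ≠ c x v := by omega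
          simp [c', adjInd, hxu, hxv, this]; ring
        · simp [c', adjInd, hxu, hxv]
      rw [h2]
      simp only [h1, Finset.sum_add_distrib, Finset.mul_sum]
      rw [Finset.sum_comm (f := fun u v => (1 - adjInd G x v) * (adjInd G v u - adjInd G x u))]
      simp only [d, ← Finset.mul_sum, Finset.sum_sub_distrib]
      ring
    have hanti : ∑ x ∈ A, ∑ v ∈ A, (1 - adjInd G x v) * (d v - d x) = 0 := by
      have : ∑ x ∈ A, ∑ v ∈ A, (1 - adjInd G x v) * (d v - d x) =
          -∑ x ∈ A, ∑ v ∈ A, (1 - adjInd G x v) * (d v - d x) := by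
        conv_lhs => rw [Finset.sum_comm]
        simp only [← Finset.sum_neg_distrib]
        refine Finset.sum_congr rfl fun u _ => Finset.sum_congr rfl fun v _ => ?_
        rw [adjInd_comm]; ring
      linarith
    have hApos : (0 : ℝ) < A.card := hb.trans_le hAb
    have hne : A.Nonempty := Finset.card_pos.1 (by exact_mod_cast hApos)
    have hsum : ∑ x ∈ A, ∑ u ∈ A, ∑ v ∈ A,
        (adjInd G u v + if c' x u = c' x v then adjInd G u v else -1) ≤
        ∑ x ∈ A, 2 * cliqueSeqCount G (j + 1 + 2) A / b ^ (j + 1) := by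
      calc _ ≤ ∑ x ∈ A, (2 * cliqueSeqCount G (j + 2) (nbrIn G x A) / b ^ j +
          2 * ∑ v ∈ A, (1 - adjInd G x v) * (d v - d x)) := Finset.sum_le_sum fun x _ => hF x
        _ = 2 * cliqueSeqCount G (j + 1 + 2) A / b ^ j := by
          rw [Finset.sum_add_distrib, ← Finset.mul_sum, hanti, ← Finset.sum_div,
            ← Finset.mul_sum, cliqueSeqCount.eq_2 G A (j + 2)]
          push_cast; ring
        _ = b * (2 * cliqueSeqCount G (j + 1 + 2) A / b ^ (j + 1)) := by
          rw [pow_succ]; field_simp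
        _ ≤ A.card * (2 * cliqueSeqCount G (j + 1 + 2) A / b ^ (j + 1)) := by gcongr
        _ = _ := by rw [Finset.sum_const, nsmul_eq_mul]
    obtain ⟨x, -, hx⟩ := Finset.exists_le_of_sum_le hne hsum
    refine ⟨c' x, fun v => ?_, hx⟩
    simp only [c']
    split_ifs
    · exact (hcj x v).trans (Nat.le_succ j)
    · exact le_rfl

lemma monoCount_update_le {V α : Type*} [Fintype V] (G : SimpleGraph V) (c : V → α)
    (hc : ∀ c' : V → α, monoCount G c ≤ monoCount G c') (v : V) (j : α) :
    degIn G v {u | c u = c v} ≤ degIn G v {u | c u = j} := by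
  classical
  have hdeg : ∀ i, (degIn G v {u | c u = i} : ℝ) = ∑ u, if c u = i then adjInd G v u else 0 := by
    intro i
    have : {u ∈ {u | c u = i} | G.Adj v u} =
        ((Finset.univ.filter fun u => c u = i ∧ G.Adj v u : Finset V) : Set V) := by
      ext; simp
    rw [degIn, this, Set.ncard_coe_finset, Finset.card_filter]
    push_cast
    refine Finset.sum_congr rfl fun u _ => ?_
    by_cases h1 : c u = i <;> by_cases h2 : G.Adj v u <;> simp [adjInd, h1, h2]
  have hsplit : ∀ f : V → V → ℝ, (∀ u w, f u w = f w u) → f v v = 0 →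
      ∑ u, ∑ w, f u w = ∑ u ∈ Finset.univ.erase v, ∑ w ∈ Finset.univ.erase v, f u w +
        2 * ∑ w, f v w := by
    intro f hf h0
    have h1 : ∀ g : V → ℝ, ∑ u, g u = ∑ u ∈ Finset.univ.erase v, g u + g v := fun g =>
      (Finset.sum_erase_add _ g (Finset.mem_univ v)).symm
    rw [h1]
    simp only [h1 (f _), Finset.sum_add_distrib, h0, hf _ v]
    ring
  have hm := hc (Function.update c v j)
  have h0 : adjInd G v v = 0 := by simp [adjInd]
  unfold monoCount at hm
  rw [hsplit _ (fun u w => by simp only [eq_comm (a := c u), adjInd_comm G u]) (by simp [h0]),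
    hsplit (fun u w => if Function.update c v j u = Function.update c v j w then adjInd G u w else 0)
      (fun u w => by simp only [eq_comm (a := Function.update c v j u), adjInd_comm G u])
      (by simp [h0])] at hm
  have h1 : ∑ u ∈ Finset.univ.erase v, ∑ w ∈ Finset.univ.erase v,
      (if Function.update c v j u = Function.update c v j w then adjInd G u w else 0) =
      ∑ u ∈ Finset.univ.erase v, ∑ w ∈ Finset.univ.erase v,
      (if c u = c w then adjInd G u w else 0) := by
    refine Finset.sum_congr rfl fun u hu => Finset.sum_congr rfl fun w hw => ?_
    rw [Function.update_of_ne (Finset.ne_of_mem_erase hu),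
      Function.update_of_ne (Finset.ne_of_mem_erase hw)]
  have h2 : ∑ w, (if Function.update c v j v = Function.update c v j w then adjInd G v w else 0) =
      ∑ w, if c w = j then adjInd G v w else 0 := by
    refine Finset.sum_congr rfl fun w _ => ?_
    by_cases hw : w = v
    · subst hw; simp [h0]
    · rw [Function.update_self, Function.update_of_ne hw]
      simp only [eq_comm]
  have h3 : ∑ w, (if c v = c w then adjInd G v w else 0) =
      ∑ w, if c w = c v then adjInd G v w else 0 := by simp only [eq_comm]
  rw [h1, h2, h3] at hm
  have : (degIn G v {u | c u = c v} : ℝ) ≤ degIn G v {u | c u = j} := by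
    rw [hdeg, hdeg]; linarith
  exact_mod_cast this

lemma two_mul_eIn {V : Type*} [Fintype V] (G : SimpleGraph V) (A : Set V) [DecidablePred (· ∈ A)] :
    2 * (eIn G A : ℝ) = ∑ u, ∑ v, if u ∈ A ∧ v ∈ A then adjInd G u v else 0 := by
  classical
  let H : SimpleGraph V :=
    { Adj := fun u v => G.Adj u v ∧ u ∈ A ∧ v ∈ A
      symm := ⟨fun u v h => ⟨h.1.symm, h.2.2, h.2.1⟩⟩
      loopless := ⟨fun u h => G.loopless.irrefl u h.1⟩ }
  have hset : {e ∈ G.edgeSet | ∀ v ∈ e, v ∈ A} = (H.edgeFinset : Set (Sym2 V)) := by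
    ext e
    induction e with
    | _ u v => simp [H]
  rw [eIn, hset, Set.ncard_coe_finset]
  have := H.sum_degrees_eq_twice_card_edges
  have h2 : 2 * (H.edgeFinset.card : ℝ) = ∑ u, (H.degree u : ℝ) := by exact_mod_cast this.symm
  rw [h2]
  refine Finset.sum_congr rfl fun u _ => ?_
  rw [← card_neighborFinset_eq_degree, neighborFinset_eq_filter, Finset.card_filter]
  push_cast
  refine Finset.sum_congr rfl fun v _ => ?_
  by_cases h1 : G.Adj u v <;> by_cases h2 : u ∈ A ∧ v ∈ A <;> simp [H, adjInd, h1, h2]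

lemma sum_eIn_fibers {V α : Type*} [Fintype V] [Fintype α] (G : SimpleGraph V) (c : V → α) :
    2 * ∑ i, (eIn G {v | c v = i} : ℝ) = monoCount G c := by
  classical
  simp only [Finset.mul_sum, two_mul_eIn, monoCount]
  rw [Finset.sum_comm]
  refine Finset.sum_congr rfl fun u _ => ?_
  rw [Finset.sum_comm]
  refine Finset.sum_congr rfl fun v _ => ?_
  simp [ite_and, eq_comm]

lemma sum_ne_fibers {V α : Type*} [Fintype V] [Fintype α] [DecidableEq α] (c : V → α) :
    ∑ u, ∑ v, (if c u = c v then (0 : ℝ) else 1) =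
      (Fintype.card V : ℝ) ^ 2 - ∑ i, ({v | c v = i}.ncard : ℝ) ^ 2 := by
  have h : ∀ i, ({v | c v = i}.ncard : ℝ) = ∑ v, if c v = i then 1 else 0 := by
    intro i
    have : {v | c v = i} = ((Finset.univ.filter fun v => c v = i : Finset V) : Set V) := by
      ext; simp
    rw [this, Set.ncard_coe_finset, Finset.card_filter]
    push_cast; rfl
  have h2 : ∑ i, ({v | c v = i}.ncard : ℝ) ^ 2 =
      ∑ u, ∑ v, if c u = c v then (1 : ℝ) else 0 := by
    simp only [h, sq, Finset.sum_mul_sum]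
    rw [Finset.sum_comm]
    refine Finset.sum_congr rfl fun u _ => ?_
    rw [Finset.sum_comm]
    refine Finset.sum_congr rfl fun v _ => ?_
    simp [eq_comm]
  have h3 : (Fintype.card V : ℝ) ^ 2 = ∑ _u : V, ∑ _v : V, (1 : ℝ) := by
    simp [sq]
  rw [h2, h3, ← Finset.sum_sub_distrib]
  refine Finset.sum_congr rfl fun u _ => ?_
  rw [← Finset.sum_sub_distrib]
  refine Finset.sum_congr rfl fun v _ => ?_
  split_ifs <;> norm_num

/-- The pairs missing between two color classes are at most half of all ordered missing pairs. -/
lemma two_mul_missing_le {V α : Type*} [Fintype V] [DecidableEq α] (G : SimpleGraph V)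
    (c : V → α) {i j : α} (hij : i ≠ j) :
    2 * (({v | c v = i}.ncard : ℝ) * {v | c v = j}.ncard -
      eBetween G {v | c v = i} {v | c v = j}) ≤
      ∑ u, ∑ v, if c u = c v then (0 : ℝ) else 1 - adjInd G u v := by
  classical
  have h : ∀ i, ({v | c v = i}.ncard : ℝ) = ∑ v, if c v = i then 1 else 0 := by
    intro i
    have : {v | c v = i} = ((Finset.univ.filter fun v => c v = i : Finset V) : Set V) := by
      ext; simp
    rw [this, Set.ncard_coe_finset, Finset.card_filter]
    push_cast; rfl
  have he : (eBetween G {v | c v = i} {v | c v = j} : ℝ) =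
      ∑ u, ∑ v, if c u = i ∧ c v = j then adjInd G u v else 0 := by
    have : {x : V × V | x.1 ∈ {v | c v = i} ∧ x.2 ∈ {v | c v = j} ∧ G.Adj x.1 x.2} =
        ((Finset.univ.filter fun x : V × V => c x.1 = i ∧ c x.2 = j ∧ G.Adj x.1 x.2 :
          Finset (V × V)) : Set (V × V)) := by
      ext; simp
    rw [eBetween, this, Set.ncard_coe_finset, Finset.card_filter, Fintype.sum_prod_type]
    push_cast
    refine Finset.sum_congr rfl fun u _ => Finset.sum_congr rfl fun v _ => ?_
    by_cases h1 : c u = i <;> by_cases h2 : c v = j <;> by_cases h3 : G.Adj u v <;>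
      simp [adjInd, h1, h2, h3]
  have hd : ({v | c v = i}.ncard : ℝ) * {v | c v = j}.ncard -
      eBetween G {v | c v = i} {v | c v = j} =
      ∑ u, ∑ v, if c u = i ∧ c v = j then 1 - adjInd G u v else 0 := by
    rw [h, h, he, Finset.sum_mul_sum, ← Finset.sum_sub_distrib]
    refine Finset.sum_congr rfl fun u _ => ?_
    rw [← Finset.sum_sub_distrib]
    refine Finset.sum_congr rfl fun v _ => ?_
    by_cases h1 : c u = i <;> by_cases h2 : c v = j <;> simp [h1, h2]
  have hd' : ∑ u, ∑ v, (if c u = i ∧ c v = j then 1 - adjInd G u v else 0) =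
      ∑ u, ∑ v, (if c u = j ∧ c v = i then 1 - adjInd G u v else 0) := by
    rw [Finset.sum_comm]
    refine Finset.sum_congr rfl fun u _ => Finset.sum_congr rfl fun v _ => ?_
    simp only [and_comm, adjInd_comm G v u]
  rw [two_mul, hd]
  nth_rewrite 2 [hd']
  rw [← Finset.sum_add_distrib]
  refine Finset.sum_le_sum fun u _ => ?_
  rw [← Finset.sum_add_distrib]
  refine Finset.sum_le_sum fun v _ => ?_
  have h1 := adjInd_le_one G u v
  by_cases hu : c u = i
  · by_cases hv : c v = j
    · simp [hu, hv, hij]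
    · simp only [hu, hv, hij, and_false, false_and, if_false, add_zero]
      split_ifs <;> linarith
  · by_cases hu' : c u = j
    · by_cases hv : c v = i
      · simp [hu', hv, hij.symm]
      · simp only [hu', hv, hij.symm, and_false, false_and, if_false, add_zero]
        split_ifs <;> linarith
    · simp only [hu, hu', false_and, if_false, add_zero]
      split_ifs <;> linarith

lemma clique_error_le (m : ℕ) (ε N T : ℝ) (hε : 0 ≤ ε) (hN : 0 < N)
    (hT : T ≤ (m + 2).factorial *
      ((((m + 2 : ℕ) : ℝ) ^ (10 * (m + 2)))⁻¹ * ε * N ^ (m + 2))) :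
    2 * T / (N / (m + 2 : ℕ)) ^ m ≤ ε * N ^ 2 / (8 * (m + 2 : ℕ)) := by
  have hnat : (m + 2).factorial * (m + 2) ^ m * (16 * (m + 2)) ≤ (m + 2) ^ (10 * (m + 2)) := by
    have h16 : 16 * (m + 2) ≤ (m + 2) ^ 5 := by
      have : 2 ^ 4 ≤ (m + 2) ^ 4 := Nat.pow_le_pow_left (by omega) 4
      calc 16 * (m + 2) ≤ (m + 2) ^ 4 * (m + 2) := Nat.mul_le_mul_right _ this
        _ = _ := by ring
    calc (m + 2).factorial * (m + 2) ^ m * (16 * (m + 2))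
        ≤ (m + 2) ^ (m + 2) * (m + 2) ^ m * (m + 2) ^ 5 := by
          gcongr
          exact Nat.factorial_le_pow _
      _ = (m + 2) ^ (m + 2 + m + 5) := by rw [← pow_add, ← pow_add]
      _ ≤ _ := Nat.pow_le_pow_right (by omega) (by omega)
  have hreal : (((m + 2).factorial : ℕ) : ℝ) * ((m + 2 : ℕ) : ℝ) ^ m * (16 * (m + 2 : ℕ)) ≤
      ((m + 2 : ℕ) : ℝ) ^ (10 * (m + 2)) := by
    have := (Nat.cast_le (α := ℝ)).2 hnat
    rwa [Nat.cast_mul, Nat.cast_mul, Nat.cast_pow, Nat.cast_pow, Nat.cast_mul,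
      Nat.cast_ofNat] at this
  have hP : (0 : ℝ) < (m + 2 : ℕ) := Nat.cast_pos.2 (Nat.succ_pos _)
  clear hnat
  generalize ((m + 2 : ℕ) : ℝ) = P at *
  generalize (((m + 2).factorial : ℕ) : ℝ) = F at *
  generalize hQ : P ^ (10 * (m + 2)) = Q at *
  have hQ0 : 0 < Q := hQ ▸ pow_pos hP _
  rw [div_pow, div_div_eq_mul_div, div_le_div_iff₀ (by positivity) (by positivity)]
  calc 2 * T * P ^ m * (8 * P) ≤ 2 * (F * (Q⁻¹ * ε * N ^ (m + 2))) * P ^ m * (8 * P) := by gcongr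
    _ = (F * P ^ m * (16 * P)) * (Q⁻¹ * ε * N ^ (m + 2)) := by ring
    _ ≤ Q * (Q⁻¹ * ε * N ^ (m + 2)) := by gcongr
    _ = ε * N ^ 2 * N ^ m := by field_simp; ring

lemma nonneighbor_budget_le (m : ℕ) (γ N : ℝ) (hN : 0 ≤ N) (hγ0 : 0 ≤ γ)
    (hγ : γ ≤ 1 / (2 * ((m + 2 : ℕ) : ℝ) ^ 2)) :
    N / (m + 2 : ℕ) + m * ((1 / (m + 1 : ℝ) + γ) * N) ≤ N + (1 / (m + 1 : ℝ) + γ) * N := by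
  push_cast at *
  have hm : (0 : ℝ) ≤ m := by positivity
  have h1 : 1 / (m + 2 : ℝ) ≤ 1 / (m + 1 : ℝ) := by gcongr; linarith
  have h2 : (m : ℝ) * γ ≤ 1 / (m + 1 : ℝ) := by
    calc (m : ℝ) * γ ≤ (m + 2) * (1 / (2 * ((m : ℝ) + 2) ^ 2)) := by gcongr; linarith
      _ = 1 / (2 * (m + 2)) := by field_simp
      _ ≤ 1 / (m + 1 : ℝ) := by gcongr; linarith
  have h3 : (m : ℝ) * (1 / (m + 1)) = 1 - 1 / (m + 1) := by field_simp; ring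
  have : 1 / (m + 2 : ℝ) + m * (1 / (m + 1 : ℝ) + γ) ≤ 1 + (1 / (m + 1 : ℝ) + γ) := by
    rw [mul_add, h3]; linarith
  calc _ = (1 / (m + 2 : ℝ) + m * (1 / (m + 1 : ℝ) + γ)) * N := by ring
    _ ≤ (1 + (1 / (m + 1 : ℝ) + γ)) * N := by gcongr
    _ = _ := by ring

lemma density_of_missing_le {ε N a b e S P K : ℝ} (hε : 0 < ε) (hK : 0 < K) (hP : P = K + 1)
    (ha : 0 ≤ a) (hb : 0 ≤ b) (he : 0 ≤ e)
    (hS : (a - N / K) ^ 2 + (b - N / K) ^ 2 ≤ S)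
    (hM : 2 * (a * b - e) ≤ (1 + 1 / (8 * P)) * ε * N ^ 2 - S) :
    (1 - P ^ 2 * ε) * a * b ≤ e := by
  by_cases h : 1 ≤ P ^ 2 * ε
  · have : (1 - P ^ 2 * ε) * a * b ≤ 0 := by
      rw [mul_assoc]
      exact mul_nonpos_of_nonpos_of_nonneg (by linarith) (by positivity)
    linarith
  · push Not at h
    have hP0 : 0 < P := by linarith
    have hab : (N / K) ^ 2 - ((a - N / K) ^ 2 + (b - N / K) ^ 2) ≤ 2 * (a * b) := by
      nlinarith [sq_nonneg (a + b - N / K)]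
    have hd : 0 ≤ (a - N / K) ^ 2 + (b - N / K) ^ 2 := by positivity
    have hPK : (1 + 1 / (8 * P)) * N ^ 2 ≤ P ^ 2 * (N / K) ^ 2 := by
      have h1 : 1 + 1 / (8 * P) ≤ P ^ 2 / K ^ 2 := by
        rw [le_div_iff₀ (by positivity)]
        have : 1 / (8 * P) * K ^ 2 ≤ K := by
          rw [div_mul_eq_mul_div, one_mul, div_le_iff₀ (by positivity)]
          nlinarith
        nlinarith
      calc _ ≤ P ^ 2 / K ^ 2 * N ^ 2 := by gcongr
        _ = _ := by field_simp
    have h1 : P ^ 2 * ε * ((N / K) ^ 2 - ((a - N / K) ^ 2 + (b - N / K) ^ 2)) ≤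
        P ^ 2 * ε * (2 * (a * b)) := by gcongr
    have h2 : P ^ 2 * ε * ((a - N / K) ^ 2 + (b - N / K) ^ 2) ≤
        1 * ((a - N / K) ^ 2 + (b - N / K) ^ 2) := by gcongr
    have h3 : ε * ((1 + 1 / (8 * P)) * N ^ 2) ≤ ε * (P ^ 2 * (N / K) ^ 2) := by gcongr
    linarith

/-- The stability-supersaturation lemma (Fox–He–Wigderson). -/
theorem stability_supersaturation (ε : ℝ) (hε : 0 < ε) (p : ℕ) (hp : 2 ≤ p)
    (γ η : ℝ) (hγ : γ = min (1 / (2 * (p : ℝ) ^ 2)) (ε / 2))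
    (hη : η = ((p : ℝ) ^ (10 * p))⁻¹ * ε) :
    ∀ n : ℕ, 10 ≤ n → ∀ G : SimpleGraph (Fin n),
      (∀ v, (1 - 1 / ((p : ℝ) - 1) - γ) * n ≤ ((G.neighborSet v).ncard : ℝ)) →
      (({s : Finset (Fin n) | G.IsNClique p s}.ncard : ℝ) ≤ η * (n : ℝ) ^ p) →
      ∃ P : Fin (p - 1) → Set (Fin n),
        (Pairwise fun i j => Disjoint (P i) (P j)) ∧ (⋃ i, P i) = Set.univ ∧
        ((∑ i, (eIn G (P i) : ℝ)) ≤ ε * (n.choose 2 : ℝ)) ∧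
        (∀ i, |((P i).ncard : ℝ) - (n : ℝ) / ((p : ℝ) - 1)| ≤ Real.sqrt (2 * ε) * n) ∧
        (∀ i j, i ≠ j →
          (1 - (p : ℝ) ^ 2 * ε) * (P i).ncard * (P j).ncard ≤ (eBetween G (P i) (P j) : ℝ)) ∧
        (∀ i j, i ≠ j → ∀ v ∈ P i, degIn G v (P i) ≤ degIn G v (P j)) := by
  classical
  intro n hn G hdeg hcl
  obtain ⟨m, rfl⟩ : ∃ m, p = m + 2 := ⟨p - 2, by omega⟩
  have hN : (10 : ℝ) ≤ n := by exact_mod_cast hn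
  have hK : (((m + 2 : ℕ) : ℝ) - 1) = m + 1 := by push_cast; ring
  rw [hK] at hdeg ⊢
  have hγ1 : γ ≤ 1 / (2 * ((m + 2 : ℕ) : ℝ) ^ 2) := hγ ▸ min_le_left _ _
  have hγ2 : γ ≤ ε / 2 := hγ ▸ min_le_right _ _
  have hγ0 : 0 ≤ γ := hγ ▸ le_min (by positivity) (by positivity)
  have hnbr : ∀ x, ((G.neighborSet x).ncard : ℝ) = (nbrIn G x Finset.univ).card := by
    intro x
    have : G.neighborSet x = (nbrIn G x Finset.univ : Set (Fin n)) := by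
      ext; simp [nbrIn]
    rw [this, Set.ncard_coe_finset]
  simp only [hnbr] at hdeg
  set δ : ℝ := (1 / (m + 1 : ℝ) + γ) * n with hδ
  have hsub : ∀ (A : Finset (Fin n)) x, (A.card : ℝ) - δ ≤ (nbrIn G x A).card := by
    intro A x
    have h1 : (nbrIn G x Finset.univ).card + A.card ≤ (nbrIn G x A).card + n := by
      have h2 := Finset.card_union_add_card_inter (nbrIn G x Finset.univ) A
      have h3 : nbrIn G x Finset.univ ∩ A = nbrIn G x A := by
        ext; simp [nbrIn, and_comm]
      have h4 := Finset.card_le_univ (nbrIn G x Finset.univ ∪ A)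
      rw [h3] at h2
      rw [Fintype.card_fin] at h4
      omega
    have h1' : ((nbrIn G x Finset.univ).card : ℝ) + A.card ≤ (nbrIn G x A).card + n := by
      exact_mod_cast h1
    have := hdeg x
    rw [hδ]
    linarith
  obtain ⟨c₀, hc₀, hF⟩ := exists_coloring_le_cliqueSeqCount G δ (n / (m + 2 : ℕ)) (by positivity)
    (by positivity) hsub m Finset.univ (by
      rw [Finset.card_univ, Fintype.card_fin]
      exact nonneighbor_budget_le m γ n (by positivity) hγ0 hγ1)
  have herr : 2 * (cliqueSeqCount G (m + 2) Finset.univ : ℝ) / (n / (m + 2 : ℕ)) ^ m ≤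
      ε * n ^ 2 / (8 * (m + 2 : ℕ)) := by
    refine clique_error_le m ε n _ hε.le (by positivity) ?_
    rw [hη] at hcl
    exact (cliqueSeqCount_univ_le G (m + 2)).trans
      (mul_le_mul_of_nonneg_left hcl (Nat.cast_nonneg _))
  obtain ⟨c, hc⟩ := Finite.exists_min fun c : Fin n → Fin (m + 1) => monoCount G c
  set c₁ : Fin n → Fin (m + 1) := fun v => ⟨c₀ v, Nat.lt_succ_of_le (hc₀ v)⟩ with hc₁
  set E : ℝ := ∑ u, ∑ v, adjInd G u v with hE
  have hE1 : (1 - 1 / (m + 1 : ℝ) - γ) * n ^ 2 ≤ E := by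
    have : ∑ _u : Fin n, (1 - 1 / (m + 1 : ℝ) - γ) * n ≤ E := by
      refine Finset.sum_le_sum fun u _ => ?_
      rw [← card_nbrIn]; exact hdeg u
    rw [Finset.sum_const, Finset.card_univ, Fintype.card_fin, nsmul_eq_mul] at this
    linarith
  have hsq : ∀ c : Fin n → Fin (m + 1),
      ∑ i, (({v | c v = i}.ncard : ℝ) - n / (m + 1 : ℝ)) ^ 2 =
        ∑ i, ({v | c v = i}.ncard : ℝ) ^ 2 - n ^ 2 / (m + 1 : ℝ) := by
    intro c
    have hs : ∑ i, ({v | c v = i}.ncard : ℝ) = n := by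
      have h : ∀ i, {v | c v = i}.ncard = (Finset.univ.filter fun v => c v = i).card := by
        intro i
        rw [← Set.ncard_coe_finset]; congr 1; ext; simp
      simp only [h]
      have := Finset.card_eq_sum_card_fiberwise (s := Finset.univ) (t := Finset.univ) (f := c)
        (fun _ _ => Finset.mem_univ _)
      rw [Finset.card_univ, Fintype.card_fin] at this
      exact_mod_cast this.symm
    simp only [sub_sq, Finset.sum_add_distrib, Finset.sum_sub_distrib, ← Finset.sum_mul,
      ← Finset.mul_sum, hs, Finset.sum_const, Finset.card_univ, Fintype.card_fin, nsmul_eq_mul]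
    push_cast
    field_simp
    ring
  have hcross : ∀ c : Fin n → Fin (m + 1),
      ∑ u, ∑ v, (if c u = c v then (0 : ℝ) else 1) = n ^ 2 - n ^ 2 / (m + 1 : ℝ) -
        ∑ i, (({v | c v = i}.ncard : ℝ) - n / (m + 1 : ℝ)) ^ 2 := by
    intro c
    rw [hsq, sum_ne_fibers, Fintype.card_fin]; ring
  have hmono₁ : monoCount G c₁ ≤ γ * n ^ 2 + ε * n ^ 2 / (8 * (m + 2 : ℕ)) := by
    have h1 : ∑ u, ∑ v, (adjInd G u v + if c₀ u = c₀ v then adjInd G u v else -1) =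
        E + monoCount G c₁ - ∑ u, ∑ v, (if c₁ u = c₁ v then (0 : ℝ) else 1) := by
      rw [hE, monoCount]
      simp only [← Finset.sum_add_distrib, ← Finset.sum_sub_distrib]
      refine Finset.sum_congr rfl fun u _ => Finset.sum_congr rfl fun v _ => ?_
      simp only [hc₁, Fin.mk.injEq]
      split_ifs <;> ring
    have h2 : 0 ≤ ∑ i, (({v | c₁ v = i}.ncard : ℝ) - n / (m + 1 : ℝ)) ^ 2 :=
      Finset.sum_nonneg fun i _ => sq_nonneg _
    rw [h1, hcross] at hF
    have h3 : (1 - 1 / (m + 1 : ℝ) - γ) * n ^ 2 = n ^ 2 - n ^ 2 / (m + 1 : ℝ) - γ * n ^ 2 := by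
      ring
    linarith
  have hmono : monoCount G c ≤ γ * n ^ 2 + ε * n ^ 2 / (8 * (m + 2 : ℕ)) := (hc c₁).trans hmono₁
  have hP16 : ε * (n : ℝ) ^ 2 / (8 * (m + 2 : ℕ)) ≤ ε * n ^ 2 / 16 := by
    gcongr
    push_cast
    have : (0 : ℝ) ≤ m := by positivity
    linarith
  have hγn : γ * (n : ℝ) ^ 2 ≤ ε / 2 * n ^ 2 := by gcongr
  set S : ℝ := ∑ i, (({v | c v = i}.ncard : ℝ) - n / (m + 1 : ℝ)) ^ 2 with hS
  have hmissing : ∑ u, ∑ v, (if c u = c v then (0 : ℝ) else 1 - adjInd G u v) ≤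
      (1 + 1 / (8 * ((m + 2 : ℕ) : ℝ))) * ε * n ^ 2 - S := by
    have h1 : ∑ u, ∑ v, (if c u = c v then (0 : ℝ) else 1 - adjInd G u v) =
        ∑ u, ∑ v, (if c u = c v then (0 : ℝ) else 1) - (E - monoCount G c) := by
      rw [hE, monoCount]
      simp only [← Finset.sum_sub_distrib]
      refine Finset.sum_congr rfl fun u _ => Finset.sum_congr rfl fun v _ => ?_
      split_ifs <;> ring
    rw [h1, hcross, ← hS]
    have h3 : (1 - 1 / (m + 1 : ℝ) - γ) * n ^ 2 = n ^ 2 - n ^ 2 / (m + 1 : ℝ) - γ * n ^ 2 := by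
      ring
    have h4 : (1 + 1 / (8 * ((m + 2 : ℕ) : ℝ))) * ε * n ^ 2 =
      ε * n ^ 2 + ε * n ^ 2 / (8 * (m + 2 : ℕ)) := by ring
    linarith
  have hmissing0 : 0 ≤ ∑ u, ∑ v, (if c u = c v then (0 : ℝ) else 1 - adjInd G u v) := by
    refine Finset.sum_nonneg fun u _ => Finset.sum_nonneg fun v _ => ?_
    have := adjInd_le_one G u v
    split_ifs <;> linarith
  refine ⟨fun i => {v | c v = i}, ?_, ?_, ?_, ?_, ?_, ?_⟩
  · intro i j hij
    rw [Set.disjoint_left]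
    intro v hv hv'
    exact hij (hv.symm.trans hv')
  · ext v; simp
  · have h1 := sum_eIn_fibers G c
    have h2 : (n.choose 2 : ℝ) = n * (n - 1) / 2 := Nat.cast_choose_two ℝ n
    have h3 : ε * (n * 10) ≤ ε * (n * n) := by gcongr
    change ∑ i : Fin (m + 1), (eIn G {v | c v = i} : ℝ) ≤ _
    rw [h2]
    nlinarith
  · intro i
    refine Real.abs_le_sqrt ?_ |>.trans ?_ (b := Real.sqrt (2 * ε * n ^ 2))
    · have h1 : (({v | c v = i}.ncard : ℝ) - n / (m + 1 : ℝ)) ^ 2 ≤ S :=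
        Finset.single_le_sum (f := fun i => (({v | c v = i}.ncard : ℝ) - n / (m + 1 : ℝ)) ^ 2)
          (fun i _ => sq_nonneg _) (Finset.mem_univ i)
      have h4 : (1 + 1 / (8 * ((m + 2 : ℕ) : ℝ))) * ε * n ^ 2 =
        ε * n ^ 2 + ε * n ^ 2 / (8 * (m + 2 : ℕ)) := by ring
      have h5 : 0 ≤ ε * (n : ℝ) ^ 2 := by positivity
      linarith
    · rw [Real.sqrt_mul (by positivity), Real.sqrt_sq (by positivity)]
  · intro i j hij
    refine density_of_missing_le (N := n) (S := S) (K := (m + 1 : ℝ)) hε (by positivity)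
      (by push_cast; ring) (by positivity) (by positivity) (by positivity) ?_
      ((two_mul_missing_le G c hij).trans hmissing)
    exact Finset.add_le_sum
      (f := fun i => (({v | c v = i}.ncard : ℝ) - n / (m + 1 : ℝ)) ^ 2)
      (fun i _ => sq_nonneg _) (Finset.mem_univ i) (Finset.mem_univ j) hij
  · rintro i j - v rfl
    exact monoCount_update_le G c hc v j
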